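/- Let H_x, H_y be complex Hilbert spaces, 1 ≤ p < ∞, B > 0, and T_p = { T ∈ S_p(H_x, H_y) : ‖T‖_{S_p} ≤ B }. Given samples (x_1, y_1),…,(x_N, y_N) ∈ H_x × H_y, let X = span{x_1,…,x_N}, Y = span{y_1,…,y_N}, Π_X, Π_Y the orthogonal projections onto X and Y, and T_N = { Π_Y T Π_X : T ∈ T_p }. Then the infimum of the empirical risk J(T) = (1/N)∑_{n=1}^N ‖y_n − T x_n‖² over T_p is attained on T_N: min_{T ∈ T_N} J(T) exists and equals inf_{T ∈ T_p} J(T). -/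

import Mathlib

open MeasureTheory
open scoped InnerProductSpace ENNReal NNReal

/-- The `n`-th approximation number of a bounded operator between complex Hilbert spaces,
`a_n(T) = inf { ‖T - A‖ : rank A ≤ n }` (indexed from `n = 0`).  For a compact operator on
Hilbert spaces this equals the `(n+1)`-st singular value `s_{n+1}(T)`, i.e. the `(n+1)`-st
eigenvalue of `|T| = (T*T)^{1/2}` in non-increasing order. -/
noncomputable def approxNumber {E F : Type*} [NormedAddCommGroup E] [NormedSpace ℂ E]
    [NormedAddCommGroup F] [NormedSpace ℂ F] (T : E →L[ℂ] F) (n : ℕ) : ℝ :=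
  sInf {r : ℝ | ∃ A : E →L[ℂ] F, LinearMap.rank (A : E →ₗ[ℂ] F) ≤ (n : Cardinal) ∧ r = ‖T - A‖}

/-- The Schatten `p`-norm `‖T‖_{S_p} = (∑_k s_k(T)^p)^{1/p}`. -/
noncomputable def schattenNorm {E F : Type*} [NormedAddCommGroup E] [NormedSpace ℂ E]
    [NormedAddCommGroup F] [NormedSpace ℂ F] (p : ℝ) (T : E →L[ℂ] F) : ℝ :=
  (∑' n : ℕ, approxNumber T n ^ p) ^ (1 / p)

/-- `T` belongs to the `p`-Schatten–von Neumann class `S_p`: `T` is compact and its singular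
values are `ℓ^p`-summable. -/
def MemSchatten {E F : Type*} [NormedAddCommGroup E] [NormedSpace ℂ E]
    [NormedAddCommGroup F] [NormedSpace ℂ F] (p : ℝ) (T : E →L[ℂ] F) : Prop :=
  IsCompactOperator T ∧ Summable fun n : ℕ => approxNumber T n ^ p

/-- `Q` is the orthogonal projection of `H` onto the subspace `K`:
every `u` is mapped into `K` and `u - Q u` is orthogonal to `K`. -/
def IsOrthoProj {H : Type*} [NormedAddCommGroup H] [InnerProductSpace ℂ H]
    (K : Submodule ℂ H) (Q : H →L[ℂ] H) : Prop :=
  ∀ u, Q u ∈ K ∧ u - Q u ∈ Kᗮ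

section ApproxNumber

variable {E F : Type*} [NormedAddCommGroup E] [NormedSpace ℂ E]
  [NormedAddCommGroup F] [NormedSpace ℂ F]

theorem approxNumber_nonneg (T : E →L[ℂ] F) (n : ℕ) : 0 ≤ approxNumber T n := by
  apply Real.sInf_nonneg
  rintro r ⟨A, -, rfl⟩
  exact norm_nonneg _

theorem approxNumber_le_norm_sub {T A : E →L[ℂ] F} {n : ℕ}
    (hA : LinearMap.rank (A : E →ₗ[ℂ] F) ≤ (n : Cardinal)) : approxNumber T n ≤ ‖T - A‖ := by
  refine csInf_le ⟨0, ?_⟩ ⟨A, hA, rfl⟩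
  rintro r ⟨A, -, rfl⟩
  exact norm_nonneg _

theorem le_approxNumber {T : E →L[ℂ] F} {n : ℕ} {c : ℝ}
    (h : ∀ A : E →L[ℂ] F, LinearMap.rank (A : E →ₗ[ℂ] F) ≤ (n : Cardinal) → c ≤ ‖T - A‖) :
    c ≤ approxNumber T n := by
  refine le_csInf ⟨_, 0, ?_, rfl⟩ ?_
  · simp
  · rintro r ⟨A, hA, rfl⟩
    exact h A hA

theorem approxNumber_zero_right (T : E →L[ℂ] F) : approxNumber T 0 = ‖T‖ := by
  apply le_antisymm
  · simpa using approxNumber_le_norm_sub (T := T) (A := 0) (n := 0) (by simp)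
  · refine le_approxNumber fun A hA => ?_
    have hA' : A = 0 := by
      have h0 : Module.rank ℂ (LinearMap.range (A : E →ₗ[ℂ] F)) = 0 := by
        simpa [LinearMap.rank] using hA
      ext x
      exact LinearMap.congr_fun (LinearMap.range_eq_bot.1 (Submodule.rank_eq_zero.1 h0)) x
    simp [hA']

theorem approxNumber_eq_zero {T : E →L[ℂ] F} {n : ℕ}
    (hT : LinearMap.rank (T : E →ₗ[ℂ] F) ≤ (n : Cardinal)) : approxNumber T n = 0 :=
  le_antisymm (by simpa using approxNumber_le_norm_sub (T := T) hT) (approxNumber_nonneg T n)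

theorem approxNumber_le_add_norm_sub (S T : E →L[ℂ] F) (n : ℕ) :
    approxNumber S n ≤ approxNumber T n + ‖S - T‖ := by
  rw [← sub_le_iff_le_add]
  refine le_approxNumber fun A hA => ?_
  have h := norm_sub_le_norm_sub_add_norm_sub S T A
  linarith [approxNumber_le_norm_sub (T := S) hA]

theorem continuous_approxNumber (n : ℕ) :
    Continuous fun T : E →L[ℂ] F => approxNumber T n := by
  have : LipschitzWith 1 fun T : E →L[ℂ] F => approxNumber T n :=
    LipschitzWith.of_le_add fun S T => by
      simpa [dist_eq_norm] using approxNumber_le_add_norm_sub S T n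
  exact this.continuous

theorem approxNumber_comp_comp_le (T : E →L[ℂ] F) {P : E →L[ℂ] E} {Q : F →L[ℂ] F}
    (hP : ‖P‖ ≤ 1) (hQ : ‖Q‖ ≤ 1) (n : ℕ) :
    approxNumber (Q ∘L T ∘L P) n ≤ approxNumber T n := by
  refine le_approxNumber fun A hA => ?_
  have hrank : LinearMap.rank ((Q ∘L A ∘L P : E →L[ℂ] F) : E →ₗ[ℂ] F) ≤ (n : Cardinal) := by
    have h1 := LinearMap.lift_rank_comp_le_right ((A ∘L P : E →L[ℂ] F) : E →ₗ[ℂ] F) (Q : F →ₗ[ℂ] F)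
    have h2 := LinearMap.rank_comp_le_left (P : E →ₗ[ℂ] E) (A : E →ₗ[ℂ] F)
    exact (Cardinal.lift_le.1 h1).trans (h2.trans hA)
  calc approxNumber (Q ∘L T ∘L P) n ≤ ‖Q ∘L T ∘L P - Q ∘L A ∘L P‖ :=
        approxNumber_le_norm_sub hrank
    _ = ‖Q ∘L (T - A) ∘L P‖ := by congr 1; ext x; simp
    _ ≤ ‖Q‖ * (‖T - A‖ * ‖P‖) :=
        (ContinuousLinearMap.opNorm_comp_le _ _).trans <|
          mul_le_mul_of_nonneg_left (ContinuousLinearMap.opNorm_comp_le _ _) (norm_nonneg _)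
    _ ≤ 1 * (‖T - A‖ * 1) := by gcongr
    _ = ‖T - A‖ := by ring

theorem schattenNorm_le_iff {p B : ℝ} (hp : 0 < p) (hB : 0 ≤ B) (T : E →L[ℂ] F) :
    schattenNorm p T ≤ B ↔ ∑' n : ℕ, approxNumber T n ^ p ≤ B ^ p := by
  rw [schattenNorm, one_div]
  exact Real.rpow_inv_le_iff_of_pos
    (tsum_nonneg fun n => Real.rpow_nonneg (approxNumber_nonneg T n) p) hB hp

theorem approxNumber_rpow_eq_zero {p : ℝ} (hp : 0 < p) {T : E →L[ℂ] F} {N : ℕ}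
    (hT : LinearMap.rank (T : E →ₗ[ℂ] F) ≤ (N : Cardinal)) {n : ℕ} (hn : n ∉ Finset.range N) :
    approxNumber T n ^ p = 0 := by
  rw [approxNumber_eq_zero, Real.zero_rpow hp.ne']
  exact hT.trans (by simpa using hn)

/-- On operators of rank at most `N`, the Schatten ball is cut out by finitely many
approximation numbers. -/
theorem memSchatten_and_schattenNorm_le_iff {p B : ℝ} (hp : 0 < p) (hB : 0 ≤ B)
    {T : E →L[ℂ] F} {N : ℕ} (hT : LinearMap.rank (T : E →ₗ[ℂ] F) ≤ (N : Cardinal)) :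
    (MemSchatten p T ∧ schattenNorm p T ≤ B) ↔
      IsCompactOperator T ∧ ∑ n ∈ Finset.range N, approxNumber T n ^ p ≤ B ^ p := by
  have h0 : ∀ n ∉ Finset.range N, approxNumber T n ^ p = 0 :=
    fun n hn => approxNumber_rpow_eq_zero hp hT hn
  rw [schattenNorm_le_iff hp hB, tsum_eq_sum h0, MemSchatten,
    and_iff_left (summable_of_ne_finset_zero h0)]

theorem MemSchatten.comp_comp {p : ℝ} (hp : 0 ≤ p) {T : E →L[ℂ] F} (hT : MemSchatten p T)
    {P : E →L[ℂ] E} {Q : F →L[ℂ] F} (hP : ‖P‖ ≤ 1) (hQ : ‖Q‖ ≤ 1) :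
    MemSchatten p (Q ∘L T ∘L P) :=
  ⟨(hT.1.comp_clm P).clm_comp Q, hT.2.of_nonneg_of_le
    (fun n => Real.rpow_nonneg (approxNumber_nonneg _ n) p)
    (fun n => Real.rpow_le_rpow (approxNumber_nonneg _ n) (approxNumber_comp_comp_le T hP hQ n) hp)⟩

theorem schattenNorm_comp_comp_le {p : ℝ} (hp : 0 ≤ p) {T : E →L[ℂ] F} (hT : MemSchatten p T)
    {P : E →L[ℂ] E} {Q : F →L[ℂ] F} (hP : ‖P‖ ≤ 1) (hQ : ‖Q‖ ≤ 1) :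
    schattenNorm p (Q ∘L T ∘L P) ≤ schattenNorm p T := by
  refine Real.rpow_le_rpow
    (tsum_nonneg fun n => Real.rpow_nonneg (approxNumber_nonneg _ n) p) ?_ (by positivity)
  exact (hT.comp_comp hp hP hQ).2.tsum_le_tsum
    (fun n => Real.rpow_le_rpow (approxNumber_nonneg _ n) (approxNumber_comp_comp_le T hP hQ n) hp)
    hT.2

/-- The operators `T` with `Q ∘ T ∘ P = T`. -/
def compressionSubmodule (P : E →L[ℂ] E) (Q : F →L[ℂ] F) : Submodule ℂ (E →L[ℂ] F) where
  carrier := {T | Q ∘L T ∘L P = T}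
  add_mem' {S T} hS hT := by
    change Q ∘L (S + T) ∘L P = S + T
    rw [ContinuousLinearMap.add_comp, ContinuousLinearMap.comp_add, hS, hT]
  zero_mem' := by
    change Q ∘L (0 : E →L[ℂ] F) ∘L P = 0
    rw [ContinuousLinearMap.zero_comp, ContinuousLinearMap.comp_zero]
  smul_mem' c T hT := by
    change Q ∘L (c • T) ∘L P = c • T
    rw [ContinuousLinearMap.smul_comp, ContinuousLinearMap.comp_smul, hT]

theorem mem_compressionSubmodule {P : E →L[ℂ] E} {Q : F →L[ℂ] F} {T : E →L[ℂ] F} :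
    T ∈ compressionSubmodule P Q ↔ Q ∘L T ∘L P = T := Iff.rfl

theorem apply_mem_of_mem_compressionSubmodule {P : E →L[ℂ] E} {Q : F →L[ℂ] F}
    {Y : Submodule ℂ F} (hQ : ∀ v, Q v ∈ Y) {T : E →L[ℂ] F}
    (hT : T ∈ compressionSubmodule P Q) (u : E) : T u ∈ Y := by
  rw [← mem_compressionSubmodule.1 hT]
  exact hQ _

theorem rank_le_of_mem_compressionSubmodule {P : E →L[ℂ] E} {Q : F →L[ℂ] F}
    {Y : Submodule ℂ F} (hQ : ∀ v, Q v ∈ Y) {T : E →L[ℂ] F}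
    (hT : T ∈ compressionSubmodule P Q) :
    LinearMap.rank (T : E →ₗ[ℂ] F) ≤ Module.rank ℂ Y := by
  refine Submodule.rank_mono ?_
  rintro _ ⟨u, rfl⟩
  exact apply_mem_of_mem_compressionSubmodule hQ hT u

theorem finiteDimensional_compressionSubmodule {P : E →L[ℂ] E} {Q : F →L[ℂ] F}
    {X : Submodule ℂ E} {Y : Submodule ℂ F} [FiniteDimensional ℂ X] [FiniteDimensional ℂ Y]
    (hP : ∀ u, P u ∈ X) (hQ : ∀ v, Q v ∈ Y) :
    FiniteDimensional ℂ (compressionSubmodule P Q) := by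
  let f : compressionSubmodule P Q →ₗ[ℂ] (X →ₗ[ℂ] Y) :=
    { toFun := fun T => ((T : E →L[ℂ] F) : E →ₗ[ℂ] F).restrict fun u _ =>
        apply_mem_of_mem_compressionSubmodule hQ T.2 u
      map_add' := fun S T => by ext; simp
      map_smul' := fun c T => by ext; simp }
  refine FiniteDimensional.of_injective f fun S T h => ?_
  ext u
  have h' : (S : E →L[ℂ] F) (P u) = (T : E →L[ℂ] F) (P u) :=
    congrArg Subtype.val (LinearMap.congr_fun h ⟨P u, hP u⟩)
  rw [← mem_compressionSubmodule.1 S.2, ← mem_compressionSubmodule.1 T.2]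
  simp [h']

/-- In a finite-dimensional space of operators of rank at most `N`, Schatten balls are compact. -/
theorem isCompact_schattenBall_inter [CompleteSpace F] {p B : ℝ} (hp : 0 < p) (hB : 0 ≤ B)
    {N : ℕ} (hN : 0 < N) (V : Submodule ℂ (E →L[ℂ] F)) [FiniteDimensional ℂ V]
    (hV : ∀ T ∈ V, LinearMap.rank (T : E →ₗ[ℂ] F) ≤ (N : Cardinal)) :
    IsCompact {T : E →L[ℂ] F | T ∈ V ∧ MemSchatten p T ∧ schattenNorm p T ≤ B} := by
  have : ProperSpace V := FiniteDimensional.proper ℂ V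
  have hcongr : {T : E →L[ℂ] F | T ∈ V ∧ MemSchatten p T ∧ schattenNorm p T ≤ B} =
      {T : E →L[ℂ] F | IsCompactOperator T} ∩
        {T | ∑ n ∈ Finset.range N, approxNumber T n ^ p ≤ B ^ p} ∩ (V : Set (E →L[ℂ] F)) := by
    ext T
    refine Iff.trans ?_ and_comm
    exact and_congr_right fun hT => memSchatten_and_schattenNorm_le_iff hp hB (hV T hT)
  have hclosed : IsClosed {T : E →L[ℂ] F | T ∈ V ∧ MemSchatten p T ∧ schattenNorm p T ≤ B} := by
    rw [hcongr]
    refine (isClosed_setOfPred_isCompactOperator.inter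
      (isClosed_le (continuous_finsetSum _ fun n _ => ?_) continuous_const)).inter
      V.closed_of_finiteDimensional
    exact (continuous_approxNumber n).rpow_const fun _ => Or.inr hp.le
  refine ((isCompact_closedBall (0 : V) B).image continuous_subtype_val).of_isClosed_subset
    hclosed fun T hT => ⟨⟨T, hT.1⟩, ?_, rfl⟩
  have hsum := ((memSchatten_and_schattenNorm_le_iff hp hB (hV T hT.1)).1 hT.2).2
  rw [mem_closedBall_zero_iff]
  change ‖T‖ ≤ B
  rw [← approxNumber_zero_right, ← Real.rpow_le_rpow_iff (approxNumber_nonneg _ _) hB hp]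
  exact (Finset.single_le_sum (f := fun n => approxNumber T n ^ p)
    (fun n _ => Real.rpow_nonneg (approxNumber_nonneg _ n) p) (Finset.mem_range.2 hN)).trans hsum

theorem memSchatten_zero_and_schattenNorm_zero_le {p B : ℝ} (hp : 0 < p) (hB : 0 ≤ B) :
    MemSchatten p (0 : E →L[ℂ] F) ∧ schattenNorm p (0 : E →L[ℂ] F) ≤ B := by
  rw [memSchatten_and_schattenNorm_le_iff (N := 0) hp hB (by simp)]
  exact ⟨isCompactOperator_zero, by simpa using Real.rpow_nonneg hB p⟩

end ApproxNumber

section IsOrthoProj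

variable {H : Type*} [NormedAddCommGroup H] [InnerProductSpace ℂ H]
  {K : Submodule ℂ H} {Q : H →L[ℂ] H}

theorem IsOrthoProj.apply_eq_self (hQ : IsOrthoProj K Q) {u : H} (hu : u ∈ K) : Q u = u := by
  have h : u - Q u ∈ K ⊓ Kᗮ := ⟨K.sub_mem hu (hQ u).1, (hQ u).2⟩
  rw [K.inf_orthogonal_eq_bot, Submodule.mem_bot, sub_eq_zero] at h
  exact h.symm

theorem IsOrthoProj.norm_apply_le (hQ : IsOrthoProj K Q) (u : H) : ‖Q u‖ ≤ ‖u‖ := by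
  have h := norm_add_sq_eq_norm_sq_add_norm_sq_of_inner_eq_zero (𝕜 := ℂ) (Q u) (u - Q u)
    ((hQ u).2 _ (hQ u).1)
  rw [add_sub_cancel] at h
  nlinarith [norm_nonneg u, norm_nonneg (Q u), mul_self_nonneg ‖u - Q u‖]

theorem IsOrthoProj.opNorm_le_one (hQ : IsOrthoProj K Q) : ‖Q‖ ≤ 1 :=
  Q.opNorm_le_bound zero_le_one fun u => by simpa using hQ.norm_apply_le u

end IsOrthoProj

/-- with `Π_X`, `Π_Y` the orthogonal projections onto
`X = span{x_1,…,x_N}` and `Y = span{y_1,…,y_N}`, the infimum of the empirical risk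
`J(T) = (1/N) ∑_n ‖y_n - T x_n‖²` over `T_p = {T ∈ S_p : ‖T‖_{S_p} ≤ B}` is attained on
`T_N = {Π_Y T Π_X : T ∈ T_p}`: there exists `T₀ ∈ T_N` minimizing `J` over `T_N` with
`J(T₀) = inf_{T ∈ T_p} J(T)`. -/
theorem statement15
    {Hx Hy : Type*} [NormedAddCommGroup Hx] [InnerProductSpace ℂ Hx] [CompleteSpace Hx]
    [NormedAddCommGroup Hy] [InnerProductSpace ℂ Hy] [CompleteSpace Hy]
    (p : ℝ) (hp : 1 ≤ p) (B : ℝ) (hB : 0 < B)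
    (N : ℕ) (hN : 0 < N) (xs : Fin N → Hx) (ys : Fin N → Hy)
    (PX : Hx →L[ℂ] Hx) (hPX : IsOrthoProj (Submodule.span ℂ (Set.range xs)) PX)
    (PY : Hy →L[ℂ] Hy) (hPY : IsOrthoProj (Submodule.span ℂ (Set.range ys)) PY) :
    ∃ T₀ : Hx →L[ℂ] Hy,
      (∃ T : Hx →L[ℂ] Hy, (MemSchatten p T ∧ schattenNorm p T ≤ B) ∧
        T₀ = PY ∘L T ∘L PX) ∧
      (∀ S : Hx →L[ℂ] Hy,
        (∃ T : Hx →L[ℂ] Hy, (MemSchatten p T ∧ schattenNorm p T ≤ B) ∧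
          S = PY ∘L T ∘L PX) →
        (N : ℝ)⁻¹ * ∑ n, ‖ys n - T₀ (xs n)‖ ^ 2 ≤
          (N : ℝ)⁻¹ * ∑ n, ‖ys n - S (xs n)‖ ^ 2) ∧
      (N : ℝ)⁻¹ * ∑ n, ‖ys n - T₀ (xs n)‖ ^ 2 =
        ⨅ T : {T : Hx →L[ℂ] Hy // MemSchatten p T ∧ schattenNorm p T ≤ B},
          (N : ℝ)⁻¹ * ∑ n, ‖ys n - (T : Hx →L[ℂ] Hy) (xs n)‖ ^ 2 := by
  have hp0 : 0 < p := one_pos.trans_le hp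
  have hPX1 := hPX.opNorm_le_one
  have hPY1 := hPY.opNorm_le_one
  have : FiniteDimensional ℂ (Submodule.span ℂ (Set.range xs)) :=
    FiniteDimensional.span_of_finite ℂ (Set.finite_range xs)
  have : FiniteDimensional ℂ (Submodule.span ℂ (Set.range ys)) :=
    FiniteDimensional.span_of_finite ℂ (Set.finite_range ys)
  have hxs : ∀ n, PX (xs n) = xs n := fun n =>
    hPX.apply_eq_self (Submodule.subset_span ⟨n, rfl⟩)
  have hys : ∀ n, PY (ys n) = ys n := fun n =>
    hPY.apply_eq_self (Submodule.subset_span ⟨n, rfl⟩)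
  have hidem : ∀ T : Hx →L[ℂ] Hy, PY ∘L T ∘L PX ∈ compressionSubmodule PX PY := fun T => by
    rw [mem_compressionSubmodule]
    ext u
    simp [hPX.apply_eq_self (hPX u).1, hPY.apply_eq_self (hPY _).1]
  have hrank : ∀ T ∈ compressionSubmodule PX PY,
      LinearMap.rank (T : Hx →ₗ[ℂ] Hy) ≤ (N : Cardinal) := fun T hT => by
    refine (rank_le_of_mem_compressionSubmodule (fun v => (hPY v).1) hT).trans ?_
    rw [← Module.finrank_eq_rank, Nat.cast_le]
    exact (finrank_range_le_card (R := ℂ) ys).trans_eq (Fintype.card_fin N)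
  have : FiniteDimensional ℂ (compressionSubmodule PX PY) :=
    finiteDimensional_compressionSubmodule (fun u => (hPX u).1) (fun v => (hPY v).1)
  have hcompact := isCompact_schattenBall_inter hp0 hB.le hN (compressionSubmodule PX PY) hrank
  obtain ⟨T₀, ⟨hT₀, hT₀B⟩, hmin⟩ := hcompact.exists_isMinOn
    ⟨0, zero_mem _, memSchatten_zero_and_schattenNorm_zero_le hp0 hB.le⟩
    (f := fun T : Hx →L[ℂ] Hy => (N : ℝ)⁻¹ * ∑ n, ‖ys n - T (xs n)‖ ^ 2)
    (Continuous.continuousOn (by fun_prop))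
  have hmin' : ∀ T : Hx →L[ℂ] Hy, MemSchatten p T ∧ schattenNorm p T ≤ B →
      (N : ℝ)⁻¹ * ∑ n, ‖ys n - T₀ (xs n)‖ ^ 2 ≤
        (N : ℝ)⁻¹ * ∑ n, ‖ys n - (PY ∘L T ∘L PX) (xs n)‖ ^ 2 := fun T hT =>
    hmin ⟨hidem T, hT.1.comp_comp hp0.le hPX1 hPY1,
      (schattenNorm_comp_comp_le hp0.le hT.1 hPX1 hPY1).trans hT.2⟩
  refine ⟨T₀, ⟨T₀, hT₀B, (mem_compressionSubmodule.1 hT₀).symm⟩, ?_, le_antisymm ?_ ?_⟩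
  · rintro S ⟨T, hT, rfl⟩
    exact hmin' T hT
  · have : Nonempty {T : Hx →L[ℂ] Hy // MemSchatten p T ∧ schattenNorm p T ≤ B} := ⟨T₀, hT₀B⟩
    refine le_ciInf fun T => (hmin' T T.2).trans ?_
    gcongr with n
    calc ‖ys n - (PY ∘L (T : Hx →L[ℂ] Hy) ∘L PX) (xs n)‖
        = ‖PY (ys n - (T : Hx →L[ℂ] Hy) (xs n))‖ := by simp [hxs, hys]
      _ ≤ _ := hPY.norm_apply_le _
  · refine ciInf_le (f := fun T : {T : Hx →L[ℂ] Hy // MemSchatten p T ∧ schattenNorm p T ≤ B} =>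
      (N : ℝ)⁻¹ * ∑ n, ‖ys n - (T : Hx →L[ℂ] Hy) (xs n)‖ ^ 2) ⟨0, ?_⟩ ⟨T₀, hT₀B⟩
    rintro _ ⟨T, rfl⟩
    positivity
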